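/- For every real r > 1 and every ε > 0 there exists an integer ℓ₀ ≥ 2 such that for every integer ℓ ≥ ℓ₀ the following holds: let k = ⌈(log ℓ)^{23}⌉ and consider the discrete-time Moran process with fitness r on the (k,ℓ,ℓ)-megastar, started from a single initial mutant placed at a uniformly random vertex; then its extinction probability is at most ε. (Equivalently: the family of (⌈(log ℓ)^{23}⌉, ℓ, ℓ)-megastars, ℓ ≥ 2, is strongly amplifying.) -/

import Mathlib

open Finset

/-- Total fitness of the mutant set `S` (mutants have fitness `r`, non-mutants fitness `1`). -/
noncomputable def moranW {V : Type*} [Fintype V] (r : ℝ) (S : Finset V) : ℝ :=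
  r * S.card + ((Fintype.card V : ℝ) - S.card)

/-- One-step transition probability of the Moran process with fitness `r` and
reproduction weights `w`, from mutant set `S` to mutant set `T`:  a vertex `u` is chosen
with probability `r / moranW r S` if it is a mutant and `1 / moranW r S` otherwise, then a
target `v` is chosen with probability `w u v`, and `v` becomes a mutant if `u` is one and
a non-mutant otherwise. -/
noncomputable def moranStep {V : Type*} [Fintype V] [DecidableEq V]
    (r : ℝ) (w : V → V → ℝ) (S T : Finset V) : ℝ :=
  ∑ u : V, ∑ v : V,
    ((if u ∈ S then r else 1) / moranW r S) * w u v *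
      (if (if u ∈ S then insert v S else S.erase v) = T then 1 else 0)

/-- Distribution of the Moran process after `t` steps, from initial distribution `init`. -/
noncomputable def moranDist {V : Type*} [Fintype V] [DecidableEq V]
    (r : ℝ) (w : V → V → ℝ) (init : Finset V → ℝ) : ℕ → Finset V → ℝ
  | 0 => init
  | t + 1 => fun T => ∑ S : Finset V, moranDist r w init t S * moranStep r w S T

/-- Reproduction weights of the (unweighted) Moran process on the digraph with
out-neighbourhoods `out`: the offspring goes to a uniformly random out-neighbour. -/
noncomputable def outWeights {V : Type*} [DecidableEq V]
    (out : V → Finset V) : V → V → ℝ :=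
  fun u v => if v ∈ out u then ((out u).card : ℝ)⁻¹ else 0

/-- Extinction probability: `sup_t Pr(S_t = ∅)`. -/
noncomputable def extinctionProb {V : Type*} [Fintype V] [DecidableEq V]
    (r : ℝ) (w : V → V → ℝ) (init : Finset V → ℝ) : ℝ :=
  ⨆ t : ℕ, moranDist r w init t (∅ : Finset V)

/-- Fixation probability: `sup_t Pr(S_t = V)`. -/
noncomputable def fixationProb {V : Type*} [Fintype V] [DecidableEq V]
    (r : ℝ) (w : V → V → ℝ) (init : Finset V → ℝ) : ℝ :=
  ⨆ t : ℕ, moranDist r w init t (Finset.univ : Finset V)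

/-- Initial distribution: a single mutant at a uniformly random vertex. -/
noncomputable def uniformSingleton (V : Type*) [Fintype V] [DecidableEq V] :
    Finset V → ℝ :=
  fun S => if S.card = 1 then (Fintype.card V : ℝ)⁻¹ else 0

/-- Initial distribution: a single mutant at the fixed vertex `x₀`. -/
def pointInit {V : Type*} [DecidableEq V] (x₀ : V) : Finset V → ℝ :=
  fun S => if S = {x₀} then 1 else 0

/-- Vertices of the `(k,ℓ,m)`-megastar: `ℓ` reservoirs `R_i` of size `m`
(`Sum.inl (i, x)`), `ℓ` feeder vertices `a_i` (`Sum.inr (Sum.inl i)`), `ℓ` cliques `K_i`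
of size `k` (`Sum.inr (Sum.inr (Sum.inl (i, x)))`), and the centre vertex `v*`
(`Sum.inr (Sum.inr (Sum.inr ()))`).  It has `1 + ℓ * (m + 1 + k)` vertices. -/
abbrev MegastarV (k ℓ m : ℕ) : Type :=
  (Fin ℓ × Fin m) ⊕ (Fin ℓ ⊕ ((Fin ℓ × Fin k) ⊕ Unit))

/-- Out-neighbourhoods of the `(k,ℓ,m)`-megastar: the centre points to every reservoir
vertex, each vertex of `R_i` points to `a_i`, each `a_i` points to every vertex of `K_i`,
the vertices within each clique `K_i` are pairwise connected in both directions, and every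
clique vertex points to the centre. -/
def megastarOut (k ℓ m : ℕ) : MegastarV k ℓ m → Finset (MegastarV k ℓ m)
  | Sum.inl (i, _) => {Sum.inr (Sum.inl i)}
  | Sum.inr (Sum.inl i) =>
      (Finset.univ : Finset (Fin k)).image fun x => Sum.inr (Sum.inr (Sum.inl (i, x)))
  | Sum.inr (Sum.inr (Sum.inl (i, x))) =>
      (((Finset.univ : Finset (Fin k)).erase x).image
          fun y => Sum.inr (Sum.inr (Sum.inl (i, y)))) ∪
        {Sum.inr (Sum.inr (Sum.inr ()))}
  | Sum.inr (Sum.inr (Sum.inr _)) =>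
      (Finset.univ : Finset (Fin ℓ × Fin m)).image fun p => Sum.inl p

/-! ### General machinery -/

/-- Unnormalised drift of `f` at the state `S`. -/
noncomputable def drift {V : Type*} [Fintype V] [DecidableEq V]
    (r : ℝ) (w : V → V → ℝ) (f : Finset V → ℝ) (S : Finset V) : ℝ :=
  ∑ v : V, if v ∈ S then (f (S.erase v) - f S) * ∑ u : V, (if u ∈ S then 0 else w u v)
    else (f (insert v S) - f S) * (r * ∑ u : V, (if u ∈ S then w u v else 0))

lemma moranW_pos {V : Type*} [Fintype V] [Nonempty V] {r : ℝ} (hr : 1 < r) (S : Finset V) :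
    0 < moranW r S := by
  unfold moranW
  have h1 : (S.card : ℝ) ≤ Fintype.card V := by exact_mod_cast S.card_le_univ
  have h2 : (0 : ℝ) < Fintype.card V := by exact_mod_cast Fintype.card_pos
  have h3 : (0 : ℝ) ≤ S.card := by positivity
  nlinarith

lemma step_expect {V : Type*} [Fintype V] [DecidableEq V]
    (r : ℝ) (w : V → V → ℝ) (f : Finset V → ℝ) (S : Finset V) :
    ∑ T : Finset V, moranStep r w S T * f T =
      ∑ u : V, ∑ v : V, ((if u ∈ S then r else 1) / moranW r S) * w u v *
        f (if u ∈ S then insert v S else S.erase v) := by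
  unfold moranStep
  simp_rw [Finset.sum_mul]
  rw [Finset.sum_comm]
  refine Finset.sum_congr rfl fun u _ => ?_
  rw [Finset.sum_comm]
  refine Finset.sum_congr rfl fun v _ => ?_
  simp_rw [mul_assoc, ← Finset.mul_sum]
  simp

lemma step_total {V : Type*} [Fintype V] [DecidableEq V] [Nonempty V]
    {r : ℝ} (hr : 1 < r) {w : V → V → ℝ} (hw : ∀ u, ∑ v, w u v = 1) (S : Finset V) :
    ∑ u : V, ∑ v : V, ((if u ∈ S then r else 1) / moranW r S) * w u v = 1 := by
  have h : ∀ u : V, ∑ v : V, ((if u ∈ S then r else 1) / moranW r S) * w u v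
      = (if u ∈ S then r else 1) / moranW r S := by
    intro u
    rw [← Finset.mul_sum, hw, mul_one]
  simp_rw [h]
  rw [← Finset.sum_div, div_eq_one_iff_eq (moranW_pos hr S).ne']
  have : ∀ u : V, (if u ∈ S then r else (1:ℝ)) = (if u ∈ S then (r - 1) else 0) + 1 := by
    intro u; split_ifs <;> ring
  simp_rw [this]
  rw [Finset.sum_add_distrib]
  simp [moranW]
  ring

lemma step_drift {V : Type*} [Fintype V] [DecidableEq V] [Nonempty V]
    {r : ℝ} (hr : 1 < r) {w : V → V → ℝ} (hw : ∀ u, ∑ v, w u v = 1) (f : Finset V → ℝ)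
    (S : Finset V) :
    ∑ T : Finset V, moranStep r w S T * f T = f S + drift r w f S / moranW r S := by
  rw [step_expect]
  have h1 : f S = ∑ u : V, ∑ v : V, ((if u ∈ S then r else 1) / moranW r S) * w u v * f S := by
    simp_rw [← Finset.sum_mul]
    rw [step_total hr hw, one_mul]
  rw [← sub_eq_iff_eq_add']
  conv_lhs => rw [h1]
  rw [← Finset.sum_sub_distrib]
  simp_rw [← Finset.sum_sub_distrib]
  rw [Finset.sum_comm]
  unfold drift
  rw [Finset.sum_div]
  refine Finset.sum_congr rfl fun v _ => ?_
  split_ifs with hv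
  · rw [Finset.mul_sum, Finset.sum_div]
    refine Finset.sum_congr rfl fun u _ => ?_
    split_ifs with hu
    · rw [Finset.insert_eq_of_mem hv]; ring
    · ring
  · rw [Finset.mul_sum, Finset.mul_sum, Finset.sum_div]
    refine Finset.sum_congr rfl fun u _ => ?_
    split_ifs with hu
    · ring
    · rw [Finset.erase_eq_of_notMem hv]; ring

/-- Probability of being extinct after `t` steps from state `S`. -/
noncomputable def extq {V : Type*} [Fintype V] [DecidableEq V]
    (r : ℝ) (w : V → V → ℝ) : ℕ → Finset V → ℝ
  | 0 => fun S => if S = ∅ then 1 else 0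
  | t + 1 => fun S => ∑ T : Finset V, moranStep r w S T * extq r w t T

lemma dist_extq {V : Type*} [Fintype V] [DecidableEq V]
    (r : ℝ) (w : V → V → ℝ) (init : Finset V → ℝ) (t s : ℕ) :
    ∑ S, moranDist r w init (t + s) S * extq r w 0 S =
      ∑ S, moranDist r w init t S * extq r w s S := by
  induction s generalizing t with
  | zero => rfl
  | succ s ih =>
    rw [show t + (s + 1) = (t + 1) + s by ring, ih]
    simp only [moranDist, extq]
    simp_rw [Finset.sum_mul, Finset.mul_sum]
    rw [Finset.sum_comm]
    simp_rw [mul_assoc]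

lemma dist_empty {V : Type*} [Fintype V] [DecidableEq V]
    (r : ℝ) (w : V → V → ℝ) (init : Finset V → ℝ) (t : ℕ) :
    moranDist r w init t ∅ = ∑ S, init S * extq r w t S := by
  have := dist_extq r w init 0 t
  simpa [extq, moranDist] using this

lemma step_nonneg {V : Type*} [Fintype V] [DecidableEq V] [Nonempty V]
    {r : ℝ} (hr : 1 < r) {w : V → V → ℝ} (hw0 : ∀ u v, 0 ≤ w u v) (S T : Finset V) :
    0 ≤ moranStep r w S T := by
  unfold moranStep
  have := moranW_pos hr S
  refine Finset.sum_nonneg fun u _ => Finset.sum_nonneg fun v _ => ?_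
  refine mul_nonneg (mul_nonneg (div_nonneg ?_ this.le) (hw0 u v)) ?_
  · split_ifs <;> linarith
  · split_ifs <;> norm_num

/-- Superharmonic comparison on a domain, with a known bound outside the domain. -/
lemma extq_le {V : Type*} [Fintype V] [DecidableEq V] [Nonempty V]
    {r : ℝ} (hr : 1 < r) {w : V → V → ℝ} (hw0 : ∀ u v, 0 ≤ w u v) (hw : ∀ u, ∑ v, w u v = 1)
    (f : Finset V → ℝ) (hf0 : ∀ S, 0 ≤ f S) (hf1 : 1 ≤ f ∅) (P : Finset V → Prop)
    (hP : ∀ S t, ¬ P S → extq r w t S ≤ f S)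
    (hd : ∀ S, P S → drift r w f S ≤ 0) (t : ℕ) (S : Finset V) :
    extq r w t S ≤ f S := by
  induction t generalizing S with
  | zero =>
    simp only [extq]
    split_ifs with h
    · rw [h]; exact hf1
    · exact hf0 S
  | succ t ih =>
    by_cases h : P S
    · calc extq r w (t + 1) S = ∑ T : Finset V, moranStep r w S T * extq r w t T := rfl
        _ ≤ ∑ T : Finset V, moranStep r w S T * f T :=
          Finset.sum_le_sum fun T _ => mul_le_mul_of_nonneg_left (ih T) (step_nonneg hr hw0 S T)
        _ = f S + drift r w f S / moranW r S := step_drift hr hw f S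
        _ ≤ f S := by
          have := div_nonpos_of_nonpos_of_nonneg (hd S h) (moranW_pos hr S).le
          linarith
    · exact hP S _ h

/-- Flow out of the mutant set. -/
noncomputable def flux {V : Type*} [Fintype V] [DecidableEq V]
    (w : V → V → ℝ) (lam : V → ℝ) (S : Finset V) : ℝ :=
  ∑ v : V, if v ∈ S then 0 else lam v * ∑ u : V, (if u ∈ S then w u v else 0)

lemma flux_symm {V : Type*} [Fintype V] [DecidableEq V]
    (w : V → V → ℝ) (lam : V → ℝ)
    (hbal : ∀ v, lam v * ∑ u, w u v = ∑ u, w v u * lam u) (S : Finset V) :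
    ∑ v : V, (if v ∈ S then lam v * ∑ u : V, (if u ∈ S then 0 else w u v) else 0)
      = flux w lam S := by
  have h1 : ∑ v : V, (if v ∈ S then lam v * ∑ u : V, (if u ∈ S then 0 else w u v) else 0)
      = ∑ v : V, (if v ∈ S then lam v * ∑ u : V, w u v else 0)
        - ∑ v : V, (if v ∈ S then lam v * ∑ u : V, (if u ∈ S then w u v else 0) else 0) := by
    rw [← Finset.sum_sub_distrib]
    refine Finset.sum_congr rfl fun v _ => ?_
    split_ifs with hv
    · rw [← mul_sub, ← Finset.sum_sub_distrib]
      congr 1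
      refine Finset.sum_congr rfl fun u _ => ?_
      split_ifs <;> ring
    · ring
  have h2 : flux w lam S = ∑ v : V, lam v * ∑ u : V, (if u ∈ S then w u v else 0)
        - ∑ v : V, (if v ∈ S then lam v * ∑ u : V, (if u ∈ S then w u v else 0) else 0) := by
    unfold flux
    rw [← Finset.sum_sub_distrib]
    refine Finset.sum_congr rfl fun v _ => ?_
    split_ifs with hv <;> ring
  have h3 : ∑ v : V, lam v * ∑ u : V, (if u ∈ S then w u v else 0)
      = ∑ v : V, (if v ∈ S then lam v * ∑ u : V, w u v else 0) := by
    simp_rw [hbal, Finset.mul_sum]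
    rw [Finset.sum_comm]
    refine Finset.sum_congr rfl fun v _ => ?_
    split_ifs with hv
    · exact Finset.sum_congr rfl fun u _ => mul_comm _ _
    · simp
  rw [h1, h2, h3]

/-- The exponential of a balanced linear potential. -/
noncomputable def epot {V : Type*} (t : ℝ) (lam : V → ℝ) (S : Finset V) : ℝ :=
  (1 / t) ^ (∑ v ∈ S, lam v)

lemma epot_drift {V : Type*} [Fintype V] [DecidableEq V]
    {t : ℝ} (ht : 1 < t) {w : V → V → ℝ} (hw0 : ∀ u v, 0 ≤ w u v) {lam : V → ℝ}
    (hl0 : ∀ v, 0 ≤ lam v) (hl1 : ∀ v, lam v ≤ 1)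
    (hbal : ∀ v, lam v * ∑ u, w u v = ∑ u, w v u * lam u) (S : Finset V) :
    drift (t ^ 2) w (epot t lam) S ≤ - ((t - 1) ^ 2 * epot t lam S * flux w lam S) := by
  have ht0 : 0 < t := by linarith
  have hs : 0 < 1 / t := by positivity
  have he : 0 ≤ epot t lam S := by unfold epot; positivity
  have key : drift (t ^ 2) w (epot t lam) S ≤
      ∑ v : V, ((t - 1) * epot t lam S *
          (if v ∈ S then lam v * ∑ u : V, (if u ∈ S then 0 else w u v) else 0)
        - (t - 1) * t * epot t lam S *
          (if v ∈ S then 0 else lam v * ∑ u : V, (if u ∈ S then w u v else 0))) := by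
    unfold drift
    refine Finset.sum_le_sum fun v _ => ?_
    split_ifs with hv
    · have hb : 0 ≤ ∑ u : V, (if u ∈ S then 0 else w u v) :=
        Finset.sum_nonneg fun u _ => by split_ifs; exacts [le_rfl, hw0 u v]
      have h1 : epot t lam (S.erase v) = epot t lam S * t ^ (lam v) := by
        unfold epot
        rw [← Finset.add_sum_erase S lam hv, Real.rpow_add hs, mul_right_comm,
          ← Real.mul_rpow hs.le ht0.le, one_div_mul_cancel ht0.ne', Real.one_rpow, one_mul]
      have h2 : t ^ (lam v) ≤ 1 + lam v * (t - 1) := by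
        have := rpow_one_add_le_one_add_mul_self (s := t - 1) (by linarith) (hl0 v) (hl1 v)
        simpa using this
      rw [h1]
      have : (epot t lam S * t ^ lam v - epot t lam S) ≤ (t - 1) * epot t lam S * lam v := by
        nlinarith
      have := mul_le_mul_of_nonneg_right this hb
      linarith
    · have hb : 0 ≤ ∑ u : V, (if u ∈ S then w u v else 0) :=
        Finset.sum_nonneg fun u _ => by split_ifs; exacts [hw0 u v, le_rfl]
      have h1 : epot t lam (insert v S) = epot t lam S * (1 / t) ^ (lam v) := by
        unfold epot
        rw [Finset.sum_insert hv, Real.rpow_add hs, mul_comm]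
      have h2 : (1 / t) ^ (lam v) ≤ 1 + lam v * (1 / t - 1) := by
        have := rpow_one_add_le_one_add_mul_self (s := 1 / t - 1) (by linarith)
          (hl0 v) (hl1 v)
        simpa using this
      rw [h1]
      have h3 : (epot t lam S * (1 / t) ^ lam v - epot t lam S) ≤
          epot t lam S * (lam v * (1 / t - 1)) := by
        nlinarith
      have h4 := mul_le_mul_of_nonneg_right h3 (mul_nonneg (sq_nonneg t) hb)
      refine h4.trans (le_of_eq ?_)
      field_simp
      ring
  refine key.trans (le_of_eq ?_)
  rw [Finset.sum_sub_distrib, ← Finset.mul_sum, ← Finset.mul_sum, flux_symm w lam hbal]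
  unfold flux
  ring

/-! ### The megastar -/

/-- Explicit reproduction weights of the megastar. -/
noncomputable def mw (k ℓ m : ℕ) : MegastarV k ℓ m → MegastarV k ℓ m → ℝ
  | Sum.inl p, Sum.inr (Sum.inl i) => if p.1 = i then 1 else 0
  | Sum.inr (Sum.inl i), Sum.inr (Sum.inr (Sum.inl q)) => if q.1 = i then (k : ℝ)⁻¹ else 0
  | Sum.inr (Sum.inr (Sum.inl p)), Sum.inr (Sum.inr (Sum.inl q)) =>
      if p.1 = q.1 then (if p.2 = q.2 then 0 else (k : ℝ)⁻¹) else 0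
  | Sum.inr (Sum.inr (Sum.inl _)), Sum.inr (Sum.inr (Sum.inr _)) => (k : ℝ)⁻¹
  | Sum.inr (Sum.inr (Sum.inr _)), Sum.inl _ => ((ℓ : ℝ) * m)⁻¹
  | _, _ => 0

lemma megastarOut_card_clique (k ℓ m : ℕ) (p : Fin ℓ × Fin k) :
    (megastarOut k ℓ m (Sum.inr (Sum.inr (Sum.inl p)))).card = k := by
  obtain ⟨i, x⟩ := p
  have hk : 0 < k := x.pos
  unfold megastarOut
  rw [Finset.card_union_of_disjoint, Finset.card_image_of_injective]
  · simp; omega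
  · intro a b h; simpa using h
  · simp

lemma outWeights_eq (k ℓ m : ℕ) : outWeights (megastarOut k ℓ m) = mw k ℓ m := by
  funext u v
  have hc := megastarOut_card_clique k ℓ m
  have ha : ∀ i, (megastarOut k ℓ m (Sum.inr (Sum.inl i))).card = k := by
    intro i
    unfold megastarOut
    rw [Finset.card_image_of_injective]
    · simp
    · intro a b h; simpa using h
  have hv : (megastarOut k ℓ m (Sum.inr (Sum.inr (Sum.inr ())))).card = ℓ * m := by
    unfold megastarOut
    rw [Finset.card_image_of_injective]
    · simp
    · intro a b h; simpa using h
  unfold outWeights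
  rcases u with p | i | p | _
  · rcases v with q | j | q | _ <;> simp [megastarOut, mw, eq_comm]
  · rw [ha]
    rcases v with q | j | ⟨j, y⟩ | _ <;> simp [megastarOut, mw, eq_comm]
  · rw [hc]
    obtain ⟨i, x⟩ := p
    rcases v with q | j | ⟨j, y⟩ | _ <;> simp [megastarOut, mw]
    by_cases h1 : i = j <;> by_cases h2 : x = y <;> simp [h1, h2, eq_comm]
  · rw [hv]
    rcases v with q | j | q | _ <;> simp [megastarOut, mw]

lemma mw_nonneg (k ℓ m : ℕ) (u v) : 0 ≤ mw k ℓ m u v := by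
  rcases u with p | i | p | _ <;> rcases v with q | j | q | _ <;> simp only [mw] <;>
    positivity

lemma sum_fst {a b : ℕ} (i : Fin a) (g : Fin a × Fin b → ℝ) :
    ∑ p : Fin a × Fin b, (if p.1 = i then g p else 0) = ∑ x, g (i, x) := by
  rw [Fintype.sum_prod_type, Finset.sum_eq_single i]
  · simp
  · intro j _ hj; simp [hj]
  · simp

lemma col_R (k ℓ m : ℕ) (g : MegastarV k ℓ m → ℝ) (p) :
    ∑ u, mw k ℓ m u (Sum.inl p) * g u = ((ℓ : ℝ) * m)⁻¹ * g (Sum.inr (Sum.inr (Sum.inr ()))) := by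
  simp [Fintype.sum_sum_type, mw]

lemma col_A (k ℓ m : ℕ) (g : MegastarV k ℓ m → ℝ) (i) :
    ∑ u, mw k ℓ m u (Sum.inr (Sum.inl i)) * g u = ∑ x, g (Sum.inl (i, x)) := by
  simp [Fintype.sum_sum_type, mw, sum_fst]

lemma col_K (k ℓ m : ℕ) (g : MegastarV k ℓ m → ℝ) (i : Fin ℓ) (y : Fin k) :
    ∑ u, mw k ℓ m u (Sum.inr (Sum.inr (Sum.inl (i, y)))) * g u =
      (k : ℝ)⁻¹ * (g (Sum.inr (Sum.inl i)) +
        ∑ x, (if x = y then 0 else g (Sum.inr (Sum.inr (Sum.inl (i, x)))))) := by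
  simp [Fintype.sum_sum_type, mw, sum_fst, mul_add, Finset.mul_sum]

lemma col_v (k ℓ m : ℕ) (g : MegastarV k ℓ m → ℝ) :
    ∑ u, mw k ℓ m u (Sum.inr (Sum.inr (Sum.inr ()))) * g u =
      (k : ℝ)⁻¹ * ∑ p, g (Sum.inr (Sum.inr (Sum.inl p))) := by
  simp [Fintype.sum_sum_type, mw, Finset.mul_sum]

lemma row_R (k ℓ m : ℕ) (g : MegastarV k ℓ m → ℝ) (p) :
    ∑ v, mw k ℓ m (Sum.inl p) v * g v = g (Sum.inr (Sum.inl p.1)) := by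
  simp [Fintype.sum_sum_type, mw]

lemma row_A (k ℓ m : ℕ) (g : MegastarV k ℓ m → ℝ) (i) :
    ∑ v, mw k ℓ m (Sum.inr (Sum.inl i)) v * g v =
      (k : ℝ)⁻¹ * ∑ x, g (Sum.inr (Sum.inr (Sum.inl (i, x)))) := by
  simp [Fintype.sum_sum_type, mw, sum_fst, Finset.mul_sum]

lemma row_K (k ℓ m : ℕ) (g : MegastarV k ℓ m → ℝ) (i : Fin ℓ) (y : Fin k) :
    ∑ v, mw k ℓ m (Sum.inr (Sum.inr (Sum.inl (i, y)))) v * g v =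
      (k : ℝ)⁻¹ * (g (Sum.inr (Sum.inr (Sum.inr ()))) +
        ∑ x, (if x = y then 0 else g (Sum.inr (Sum.inr (Sum.inl (i, x)))))) := by
  have : ∀ p : Fin ℓ × Fin k, mw k ℓ m (Sum.inr (Sum.inr (Sum.inl (i, y))))
      (Sum.inr (Sum.inr (Sum.inl p))) * g (Sum.inr (Sum.inr (Sum.inl p))) =
      if p.1 = i then (if p.2 = y then 0 else
        (k : ℝ)⁻¹ * g (Sum.inr (Sum.inr (Sum.inl p)))) else 0 := by
    rintro ⟨j, x⟩
    by_cases h1 : i = j <;> by_cases h2 : y = x <;> simp [mw, h1, h2, eq_comm]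
  simp only [Fintype.sum_sum_type, this]
  simp [mw, sum_fst, mul_add, Finset.mul_sum, add_comm]

lemma row_v (k ℓ m : ℕ) (g : MegastarV k ℓ m → ℝ) :
    ∑ v, mw k ℓ m (Sum.inr (Sum.inr (Sum.inr ()))) v * g v =
      ((ℓ : ℝ) * m)⁻¹ * ∑ p, g (Sum.inl p) := by
  simp [Fintype.sum_sum_type, mw, Finset.mul_sum]

/-- Sum of an indicator over all indices but one. -/
lemma sum_ne {k : ℕ} (y : Fin k) (g : Fin k → ℝ) :
    ∑ x, (if x = y then 0 else g x) = ∑ x, g x - g y := by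
  have : ∀ x, (if x = y then 0 else g x) = g x - if x = y then g x else 0 := by
    intro x; split_ifs <;> simp
  simp_rw [this, Finset.sum_sub_distrib]
  simp

lemma mw_row (k ℓ m : ℕ) (hk : 0 < k) (hl : 0 < ℓ) (hm : 0 < m) (u) :
    ∑ v, mw k ℓ m u v = 1 := by
  have hk' : (k : ℝ) ≠ 0 := by positivity
  have hl' : (ℓ : ℝ) ≠ 0 := by positivity
  have hm' : (m : ℝ) ≠ 0 := by positivity
  have h1 : ∑ v, mw k ℓ m u v = ∑ v, mw k ℓ m u v * (fun _ => (1:ℝ)) v := by simp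
  rw [h1]
  rcases u with p | i | ⟨i, x⟩ | _
  · rw [row_R]
  · rw [row_A]; simp [hk']
  · rw [row_K, sum_ne]; simp [hk']
  · rw [row_v]; simp; field_simp

/-- The balanced weights. -/
noncomputable def mlam (k ℓ m : ℕ) : MegastarV k ℓ m → ℝ
  | Sum.inl _ => 1
  | Sum.inr (Sum.inl _) => ((ℓ : ℝ) * m)⁻¹
  | Sum.inr (Sum.inr _) => (ℓ : ℝ)⁻¹

lemma mlam_nonneg (k ℓ m : ℕ) (u) : 0 ≤ mlam k ℓ m u := by
  rcases u with p | i | u <;> simp only [mlam] <;> positivity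

lemma mlam_le (k ℓ m : ℕ) (hl : 0 < ℓ) (hm : 0 < m) (u) : mlam k ℓ m u ≤ 1 := by
  have hl' : (1 : ℝ) ≤ ℓ := by exact_mod_cast hl
  have hm' : (1 : ℝ) ≤ m := by exact_mod_cast hm
  rcases u with p | i | u <;> simp only [mlam]
  · exact le_rfl
  · exact inv_le_one_of_one_le₀ (by nlinarith)
  · exact inv_le_one_of_one_le₀ hl'

lemma mlam_bal (k ℓ m : ℕ) (hk : 0 < k) (hl : 0 < ℓ) (hm : 0 < m) (v) :
    mlam k ℓ m v * ∑ u, mw k ℓ m u v = ∑ u, mw k ℓ m v u * mlam k ℓ m u := by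
  have hk' : (k : ℝ) ≠ 0 := by positivity
  have hl' : (ℓ : ℝ) ≠ 0 := by positivity
  have hm' : (m : ℝ) ≠ 0 := by positivity
  have h1 : ∑ u, mw k ℓ m u v = ∑ u, mw k ℓ m u v * (fun _ => (1:ℝ)) u := by simp
  rw [h1]
  rcases v with p | i | ⟨i, x⟩ | _
  · rw [row_R, col_R]; simp [mlam]
  · rw [row_A, col_A]; simp [mlam]; field_simp
  · rw [row_K, col_K, sum_ne, sum_ne]; simp [mlam]; field_simp
  · rw [row_v, col_v]; simp [mlam]; field_simp

/-- The number of mutants in the `i`-th clique. -/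
noncomputable def cliq {k ℓ m : ℕ} (i : Fin ℓ) (S : Finset (MegastarV k ℓ m)) : Finset (Fin k) :=
  Finset.univ.filter fun y => Sum.inr (Sum.inr (Sum.inl (i, y))) ∈ S

lemma col_ite_in {V : Type*} [Fintype V] [DecidableEq V] (w : V → V → ℝ) (S : Finset V) (v : V) :
    ∑ u : V, (if u ∈ S then w u v else 0) = ∑ u, w u v * (fun u => if u ∈ S then (1:ℝ) else 0) u := by
  simp

lemma col_ite_out {V : Type*} [Fintype V] [DecidableEq V] (w : V → V → ℝ) (S : Finset V) (v : V) :
    ∑ u : V, (if u ∈ S then 0 else w u v) = ∑ u, w u v * (fun u => if u ∈ S then (0:ℝ) else 1) u := by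
  simp

lemma flux_lower {k ℓ m : ℕ} (hk : 0 < k) (hl : 0 < ℓ) (hm : 0 < m)
    (i : Fin ℓ) (S : Finset (MegastarV k ℓ m)) (N : ℝ) (hN : 2 * N ≤ (ℓ : ℝ) * m)
    (hS : ∑ v ∈ S, mlam k ℓ m v ≤ N) (hj : 0 < (cliq i S).card) :
    (2 * (ℓ : ℝ))⁻¹ ≤ flux (mw k ℓ m) (mlam k ℓ m) S := by
  have hk' : (0:ℝ) < k := by positivity
  have hl' : (1:ℝ) ≤ ℓ := by exact_mod_cast hl
  have hm' : (1:ℝ) ≤ m := by exact_mod_cast hm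
  have hlm : (0:ℝ) < (ℓ:ℝ) * m := by positivity
  have hin : ∀ v, 0 ≤ ∑ u : MegastarV k ℓ m, (if u ∈ S then mw k ℓ m u v else 0) := fun v =>
    Finset.sum_nonneg fun u _ => by split_ifs; exacts [mw_nonneg _ _ _ u v, le_rfl]
  have hterm : ∀ v : MegastarV k ℓ m, 0 ≤ (if v ∈ S then 0 else mlam k ℓ m v *
      ∑ u : MegastarV k ℓ m, (if u ∈ S then mw k ℓ m u v else 0)) := fun v => by
    split_ifs
    exacts [le_rfl, mul_nonneg (mlam_nonneg _ _ _ v) (hin v)]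
  unfold flux
  by_cases hc : (Sum.inr (Sum.inr (Sum.inr ())) : MegastarV k ℓ m) ∈ S
  · have h1 : ∑ p : Fin ℓ × Fin m, (if (Sum.inl p : MegastarV k ℓ m) ∈ S then (1:ℝ) else 0) ≤ N := by
      refine le_trans ?_ hS
      have : ∑ v ∈ S, mlam k ℓ m v = ∑ v, if v ∈ S then mlam k ℓ m v else 0 := by simp
      rw [this, Fintype.sum_sum_type]
      refine le_add_of_le_of_nonneg (le_of_eq rfl) ?_
      exact Finset.sum_nonneg fun u _ => by split_ifs; exacts [mlam_nonneg _ _ _ _, le_rfl]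
    have h2 : ∀ p : Fin ℓ × Fin m, (if (Sum.inl p : MegastarV k ℓ m) ∈ S then 0
        else mlam k ℓ m (Sum.inl p) * ∑ u, (if u ∈ S then mw k ℓ m u (Sum.inl p) else 0)) =
        ((ℓ : ℝ) * m)⁻¹ * (1 - (if (Sum.inl p : MegastarV k ℓ m) ∈ S then (1:ℝ) else 0)) := by
      intro p
      rw [col_ite_in, col_R]
      split_ifs <;> simp [mlam]
    rw [Fintype.sum_sum_type]
    refine le_add_of_le_of_nonneg ?_ (Finset.sum_nonneg fun u _ => hterm _)
    simp_rw [h2]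
    rw [← Finset.mul_sum, Finset.sum_sub_distrib]
    simp only [Finset.sum_const, Finset.card_univ, Fintype.card_prod, Fintype.card_fin,
      nsmul_eq_mul, mul_one, Nat.cast_mul]
    have h3 : (2 * (ℓ : ℝ))⁻¹ ≤ 2⁻¹ := by
      apply inv_anti₀ <;> linarith
    refine h3.trans ?_
    rw [inv_mul_eq_div, le_div_iff₀ hlm]
    linarith
  · set j : ℕ := (cliq i S).card with hjdef
    have hjk : j ≤ k := by simpa using (cliq i S).card_le_univ
    have hjs : ∑ x : Fin k, (if (Sum.inr (Sum.inr (Sum.inl (i, x))) : MegastarV k ℓ m) ∈ S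
        then (1:ℝ) else 0) = j := by
      rw [hjdef]; unfold cliq; simp
    rw [Fintype.sum_sum_type, Fintype.sum_sum_type, Fintype.sum_sum_type]
    have e1 := Finset.sum_nonneg (s := Finset.univ) fun (p : Fin ℓ × Fin m) _ => hterm (Sum.inl p)
    have e2 := Finset.sum_nonneg (s := Finset.univ) fun (p : Fin ℓ) _ =>
      hterm (Sum.inr (Sum.inl p))
    have e3 : (ℓ : ℝ)⁻¹ * ((k:ℝ)⁻¹ * ((k - j) * j)) ≤ ∑ p : Fin ℓ × Fin k,
        (if (Sum.inr (Sum.inr (Sum.inl p)) : MegastarV k ℓ m) ∈ S then 0 else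
          mlam k ℓ m (Sum.inr (Sum.inr (Sum.inl p))) *
          ∑ u, (if u ∈ S then mw k ℓ m u (Sum.inr (Sum.inr (Sum.inl p))) else 0)) := by
      rw [Fintype.sum_prod_type]
      refine le_trans ?_ (Finset.single_le_sum (fun a _ => Finset.sum_nonneg fun b _ =>
        hterm (Sum.inr (Sum.inr (Sum.inl (a, b))))) (Finset.mem_univ i))
      have : ∀ y : Fin k, (ℓ : ℝ)⁻¹ * ((k:ℝ)⁻¹ * j) *
          (1 - if (Sum.inr (Sum.inr (Sum.inl (i, y))) : MegastarV k ℓ m) ∈ S then (1:ℝ) else 0) ≤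
          (if (Sum.inr (Sum.inr (Sum.inl (i, y))) : MegastarV k ℓ m) ∈ S then 0 else
          mlam k ℓ m (Sum.inr (Sum.inr (Sum.inl (i, y)))) *
          ∑ u, (if u ∈ S then mw k ℓ m u (Sum.inr (Sum.inr (Sum.inl (i, y)))) else 0)) := by
        intro y
        rw [col_ite_in, col_K, sum_ne, hjs]
        split_ifs
        · simp
        · simp only [mlam]; simp; gcongr; simp
        · simp [mlam]
      refine le_trans ?_ (Finset.sum_le_sum fun y _ => this y)
      rw [← Finset.mul_sum, Finset.sum_sub_distrib, hjs]
      simp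
      apply le_of_eq; ring
    have e4 : (ℓ : ℝ)⁻¹ * ((k:ℝ)⁻¹ * j) ≤ ∑ x : Unit,
        (if (Sum.inr (Sum.inr (Sum.inr x)) : MegastarV k ℓ m) ∈ S then 0 else
          mlam k ℓ m (Sum.inr (Sum.inr (Sum.inr x))) *
          ∑ u, (if u ∈ S then mw k ℓ m u (Sum.inr (Sum.inr (Sum.inr x))) else 0)) := by
      simp only [Finset.univ_unique, Finset.sum_singleton, PUnit.default_eq_unit]
      rw [if_neg hc, col_ite_in, col_v]
      simp only [mlam]
      gcongr
      rw [Fintype.sum_prod_type, ← hjs]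
      exact Finset.single_le_sum (f := fun a => ∑ x : Fin k,
        (if (Sum.inr (Sum.inr (Sum.inl (a, x))) : MegastarV k ℓ m) ∈ S then (1:ℝ) else 0))
        (fun a _ => Finset.sum_nonneg fun b _ => by split_ifs <;> norm_num) (Finset.mem_univ i)
    have e5 : (2 * (ℓ : ℝ))⁻¹ ≤ (ℓ : ℝ)⁻¹ * ((k:ℝ)⁻¹ * ((k - j) * j)) +
        (ℓ : ℝ)⁻¹ * ((k:ℝ)⁻¹ * j) := by
      have h1 : (1:ℝ) ≤ j := by exact_mod_cast hj
      have h2 : (j:ℝ) ≤ k := by exact_mod_cast hjk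
      have h3 : (k:ℝ) ≤ (k - j) * j + j := by nlinarith
      have h4 : 1 ≤ (k:ℝ)⁻¹ * ((k - j) * j + j) := by
        rw [inv_mul_eq_div, le_div_iff₀ hk']; linarith
      have h5 : (ℓ:ℝ)⁻¹ * 1 ≤ (ℓ:ℝ)⁻¹ * ((k:ℝ)⁻¹ * ((k - j) * j + j)) := by gcongr
      have h6 : (2 * (ℓ : ℝ))⁻¹ ≤ (ℓ:ℝ)⁻¹ := by apply inv_anti₀ <;> linarith
      linarith
    linarith

/-! ### The gadget potential -/

/-- Reservoir/feeder factor of the gadget potential. -/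
noncomputable def gth {k ℓ m : ℕ} (β γ : ℝ) (i : Fin ℓ) (x : Fin m)
    (S : Finset (MegastarV k ℓ m)) : ℝ :=
  if (Sum.inl (i, x) : MegastarV k ℓ m) ∈ S then
    (if (Sum.inr (Sum.inl i) : MegastarV k ℓ m) ∈ S then β * (1 - γ) else β) else 1

/-- The gadget potential. -/
noncomputable def gB {k ℓ m : ℕ} (t β γ : ℝ) (i : Fin ℓ) (x : Fin m)
    (S : Finset (MegastarV k ℓ m)) : ℝ :=
  (1 / t) ^ (cliq i S).card * gth β γ i x S

lemma gth_bounds {k ℓ m : ℕ} {β γ : ℝ} (hβ0 : 0 ≤ β) (hβ1 : β ≤ 1) (hγ0 : 0 ≤ γ) (hγ1 : γ ≤ 1)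
    (i : Fin ℓ) (x : Fin m) (S : Finset (MegastarV k ℓ m)) :
    0 ≤ gth β γ i x S ∧ gth β γ i x S ≤ 1 := by
  unfold gth
  split_ifs
  · constructor <;> nlinarith
  · exact ⟨hβ0, hβ1⟩
  · norm_num

/-- Contribution of a vertex to the drift. -/
noncomputable def dterm {V : Type*} [Fintype V] [DecidableEq V]
    (r : ℝ) (w : V → V → ℝ) (f : Finset V → ℝ) (S : Finset V) (v : V) : ℝ :=
  if v ∈ S then (f (S.erase v) - f S) * ∑ u : V, (if u ∈ S then 0 else w u v)
    else (f (insert v S) - f S) * (r * ∑ u : V, (if u ∈ S then w u v else 0))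

lemma cliq_insert_of_ne {k ℓ m : ℕ} (i : Fin ℓ) (S : Finset (MegastarV k ℓ m)) (v)
    (hv : ∀ y, v ≠ Sum.inr (Sum.inr (Sum.inl (i, y)))) : cliq i (insert v S) = cliq i S := by
  unfold cliq
  ext y
  have := (hv y).symm
  simp [this]

lemma cliq_erase_of_ne {k ℓ m : ℕ} (i : Fin ℓ) (S : Finset (MegastarV k ℓ m)) (v)
    (hv : ∀ y, v ≠ Sum.inr (Sum.inr (Sum.inl (i, y)))) : cliq i (S.erase v) = cliq i S := by
  unfold cliq
  ext y
  have := (hv y).symm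
  simp [this]

lemma gth_insert_of_ne {k ℓ m : ℕ} (β γ : ℝ) (i : Fin ℓ) (x : Fin m)
    (S : Finset (MegastarV k ℓ m)) (v)
    (hv : v ≠ Sum.inl (i, x)) (hv2 : v ≠ Sum.inr (Sum.inl i)) :
    gth β γ i x (insert v S) = gth β γ i x S := by
  unfold gth
  simp [hv.symm, hv2.symm]

lemma gth_erase_of_ne {k ℓ m : ℕ} (β γ : ℝ) (i : Fin ℓ) (x : Fin m)
    (S : Finset (MegastarV k ℓ m)) (v)
    (hv : v ≠ Sum.inl (i, x)) (hv2 : v ≠ Sum.inr (Sum.inl i)) :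
    gth β γ i x (S.erase v) = gth β γ i x S := by
  unfold gth
  simp [hv.symm, hv2.symm]

lemma gB_dterm_zero {k ℓ m : ℕ} (r t β γ : ℝ) (i : Fin ℓ) (x : Fin m)
    (S : Finset (MegastarV k ℓ m)) (v)
    (hv : v ≠ Sum.inl (i, x)) (hv2 : v ≠ Sum.inr (Sum.inl i))
    (hv3 : ∀ y, v ≠ Sum.inr (Sum.inr (Sum.inl (i, y)))) :
    dterm r (mw k ℓ m) (gB t β γ i x) S v = 0 := by
  unfold dterm gB
  rw [cliq_insert_of_ne i S v hv3, cliq_erase_of_ne i S v hv3, gth_insert_of_ne _ _ _ _ _ _ hv hv2,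
    gth_erase_of_ne _ _ _ _ _ _ hv hv2]
  simp

lemma gB_drift_split {k ℓ m : ℕ} (r t β γ : ℝ) (i : Fin ℓ) (x : Fin m)
    (S : Finset (MegastarV k ℓ m)) :
    drift r (mw k ℓ m) (gB t β γ i x) S =
      dterm r (mw k ℓ m) (gB t β γ i x) S (Sum.inl (i, x)) +
      dterm r (mw k ℓ m) (gB t β γ i x) S (Sum.inr (Sum.inl i)) +
      ∑ y, dterm r (mw k ℓ m) (gB t β γ i x) S (Sum.inr (Sum.inr (Sum.inl (i, y)))) := by
  have h0 : drift r (mw k ℓ m) (gB t β γ i x) S =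
    ∑ v, dterm r (mw k ℓ m) (gB t β γ i x) S v := rfl
  rw [h0, Fintype.sum_sum_type, Fintype.sum_sum_type, Fintype.sum_sum_type]
  have h1 : ∑ p, dterm r (mw k ℓ m) (gB t β γ i x) S (Sum.inl p) =
      dterm r (mw k ℓ m) (gB t β γ i x) S (Sum.inl (i, x)) := by
    refine Finset.sum_eq_single (i, x) (fun p _ hp => gB_dterm_zero _ _ _ _ _ _ _ _ ?_ ?_ ?_) ?_
    · simpa using hp
    · simp
    · simp
    · simp
  have h2 : ∑ p, dterm r (mw k ℓ m) (gB t β γ i x) S (Sum.inr (Sum.inl p)) =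
      dterm r (mw k ℓ m) (gB t β γ i x) S (Sum.inr (Sum.inl i)) := by
    refine Finset.sum_eq_single i (fun p _ hp => gB_dterm_zero _ _ _ _ _ _ _ _ ?_ ?_ ?_) ?_
    · simp
    · simpa using hp
    · simp
    · simp
  have h3 : ∑ p, dterm r (mw k ℓ m) (gB t β γ i x) S (Sum.inr (Sum.inr (Sum.inl p))) =
      ∑ y, dterm r (mw k ℓ m) (gB t β γ i x) S (Sum.inr (Sum.inr (Sum.inl (i, y)))) := by
    rw [Fintype.sum_prod_type]
    refine Finset.sum_eq_single i (fun p _ hp => Finset.sum_eq_zero fun y _ =>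
      gB_dterm_zero _ _ _ _ _ _ _ _ ?_ ?_ ?_) ?_
    · simp
    · simp
    · intro z hz
      simp at hz
      exact hp hz.1
    · simp
  have h4 : ∑ p : Unit, dterm r (mw k ℓ m) (gB t β γ i x) S (Sum.inr (Sum.inr (Sum.inr p))) = 0 := by
    refine Finset.sum_eq_zero fun y _ => gB_dterm_zero _ _ _ _ _ _ _ _ ?_ ?_ ?_ <;> simp
  rw [h1, h2, h3, h4]
  ring

lemma gB_dterm_x {k ℓ m : ℕ} {r t β γ : ℝ} (hr : 0 ≤ r) (ht : 0 < t)
    (hβ0 : 0 ≤ β) (hβ1 : β ≤ 1) (hγ0 : 0 ≤ γ) (hγ1 : γ ≤ 1) (i : Fin ℓ) (x : Fin m)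
    (S : Finset (MegastarV k ℓ m)) :
    dterm r (mw k ℓ m) (gB t β γ i x) S (Sum.inl (i, x)) ≤
      if (Sum.inl (i, x) : MegastarV k ℓ m) ∈ S then
        (1 / t) ^ (cliq i S).card * ((ℓ : ℝ) * m)⁻¹ else 0 := by
  unfold dterm
  have hp : 0 ≤ (1 / t) ^ (cliq i S).card := by positivity
  have hlm : 0 ≤ ((ℓ : ℝ) * m)⁻¹ := by positivity
  split_ifs with h
  · have hb := gth_bounds hβ0 hβ1 hγ0 hγ1 i x S
    rw [col_ite_out, col_R]
    have e : gB t β γ i x (S.erase (Sum.inl (i, x))) = (1 / t) ^ (cliq i S).card := by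
      unfold gB
      rw [cliq_erase_of_ne _ _ _ (by simp)]
      simp [gth]
    rw [e]
    have h1 : 0 ≤ gB t β γ i x S := mul_nonneg hp hb.1
    have h2 : gB t β γ i x S ≤ (1 / t) ^ (cliq i S).card := mul_le_of_le_one_right hp hb.2
    have h3 : ((ℓ : ℝ) * m)⁻¹ * (fun u : MegastarV k ℓ m => if u ∈ S then (0:ℝ) else 1)
      (Sum.inr (Sum.inr (Sum.inr ()))) ≤ ((ℓ : ℝ) * m)⁻¹ := by
      apply mul_le_of_le_one_right hlm
      dsimp only
      split_ifs <;> norm_num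
    exact mul_le_mul (by linarith) h3 (mul_nonneg hlm (by split_ifs <;> norm_num)) hp
  · apply mul_nonpos_of_nonpos_of_nonneg
    · have hb := gth_bounds hβ0 hβ1 hγ0 hγ1 i x (insert (Sum.inl (i, x)) S)
      have e : gB t β γ i x S = (1 / t) ^ (cliq i S).card := by
        unfold gB
        simp [gth, h]
      rw [e]
      unfold gB
      rw [cliq_insert_of_ne _ _ _ (by simp)]
      have := mul_le_of_le_one_right hp hb.2
      linarith
    · exact mul_nonneg hr (Finset.sum_nonneg fun u _ => by
        split_ifs; exacts [mw_nonneg _ _ _ _ _, le_rfl])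

lemma gB_dterm_a {k ℓ m : ℕ} {r t β γ : ℝ} (hr : 0 ≤ r) (ht : 0 < t)
    (hβ0 : 0 ≤ β) (hγ0 : 0 ≤ γ) (i : Fin ℓ) (x : Fin m)
    (S : Finset (MegastarV k ℓ m)) :
    dterm r (mw k ℓ m) (gB t β γ i x) S (Sum.inr (Sum.inl i)) ≤
      if (Sum.inl (i, x) : MegastarV k ℓ m) ∈ S then
        (if (Sum.inr (Sum.inl i) : MegastarV k ℓ m) ∈ S then
          (1 / t) ^ (cliq i S).card * (β * γ) * m
        else - ((1 / t) ^ (cliq i S).card * (β * γ) * r)) else 0 := by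
  unfold dterm
  have hp : 0 ≤ (1 / t) ^ (cliq i S).card := by positivity
  have hpb : 0 ≤ (1 / t) ^ (cliq i S).card * (β * γ) := by positivity
  by_cases ha : (Sum.inr (Sum.inl i) : MegastarV k ℓ m) ∈ S <;>
    by_cases hx : (Sum.inl (i, x) : MegastarV k ℓ m) ∈ S
  · simp only [ha, hx, if_true]
    rw [col_ite_out, col_A]
    have e : gB t β γ i x (S.erase (Sum.inr (Sum.inl i))) - gB t β γ i x S =
        (1 / t) ^ (cliq i S).card * (β * γ) := by
      unfold gB
      rw [cliq_erase_of_ne _ _ _ (by simp)]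
      simp [gth, hx, ha]
      ring
    rw [e]
    apply mul_le_mul_of_nonneg_left _ hpb
    calc _ ≤ ∑ x : Fin m, (1:ℝ) := Finset.sum_le_sum fun y _ => by split_ifs <;> norm_num
      _ = m := by simp
  · simp only [ha, hx, if_true, if_false]
    have e : gB t β γ i x (S.erase (Sum.inr (Sum.inl i))) - gB t β γ i x S = 0 := by
      unfold gB
      rw [cliq_erase_of_ne _ _ _ (by simp)]
      simp [gth, hx]
    rw [e]; simp
  · simp only [ha, hx, if_true, if_false]
    rw [col_ite_in, col_A]
    have e : gB t β γ i x (insert (Sum.inr (Sum.inl i)) S) - gB t β γ i x S =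
        - ((1 / t) ^ (cliq i S).card * (β * γ)) := by
      unfold gB
      rw [cliq_insert_of_ne _ _ _ (by simp)]
      simp [gth, hx, ha]
      ring
    rw [e]
    have h1 : (1:ℝ) ≤ ∑ y, (fun u : MegastarV k ℓ m => if u ∈ S then (1:ℝ) else 0)
        (Sum.inl (i, y)) := by
      refine le_trans ?_ (Finset.single_le_sum (fun y _ => ?_) (Finset.mem_univ x))
      · simp [hx]
      · dsimp only; split_ifs <;> norm_num
    have h2 := mul_le_mul_of_nonneg_left (mul_le_mul_of_nonneg_left h1 hr) hpb
    linarith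
  · simp only [ha, hx, if_false]
    have e : gB t β γ i x (insert (Sum.inr (Sum.inl i)) S) - gB t β γ i x S = 0 := by
      unfold gB
      rw [cliq_insert_of_ne _ _ _ (by simp)]
      simp [gth, hx]
    rw [e]; simp

lemma gB_dterm_K {k ℓ m : ℕ} {t β γ : ℝ} (ht : 0 < t) (i : Fin ℓ) (x : Fin m)
    (S : Finset (MegastarV k ℓ m)) (α : ℝ)
    (hα : α = if (Sum.inr (Sum.inl i) : MegastarV k ℓ m) ∈ S then 1 else 0) :
    ∑ y, dterm (t ^ 2) (mw k ℓ m) (gB t β γ i x) S (Sum.inr (Sum.inr (Sum.inl (i, y)))) =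
      gth β γ i x S * (1 / t) ^ (cliq i S).card * (t - 1) * (k : ℝ)⁻¹ *
        ((cliq i S).card * (k - (cliq i S).card + (1 - α)) -
          t * (k - (cliq i S).card) * ((cliq i S).card + α)) := by
  set j : ℕ := (cliq i S).card with hjdef
  have hjs : ∑ x : Fin k, (if (Sum.inr (Sum.inr (Sum.inl (i, x))) : MegastarV k ℓ m) ∈ S
      then (1:ℝ) else 0) = j := by
    rw [hjdef]; unfold cliq; simp
  have hjs' : ∑ x : Fin k, (if (Sum.inr (Sum.inr (Sum.inl (i, x))) : MegastarV k ℓ m) ∈ S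
      then (0:ℝ) else 1) = k - j := by
    have : ∑ x : Fin k, ((if (Sum.inr (Sum.inr (Sum.inl (i, x))) : MegastarV k ℓ m) ∈ S
      then (0:ℝ) else 1) + (if (Sum.inr (Sum.inr (Sum.inl (i, x))) : MegastarV k ℓ m) ∈ S
      then (1:ℝ) else 0)) = k := by
      rw [Finset.sum_congr rfl (g := fun _ => (1:ℝ)) (fun x _ => by split_ifs <;> norm_num)]
      simp
    rw [Finset.sum_add_distrib, hjs] at this
    linarith
  have hy : ∀ y : Fin k, dterm (t ^ 2) (mw k ℓ m) (gB t β γ i x) S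
      (Sum.inr (Sum.inr (Sum.inl (i, y)))) =
      gth β γ i x S * (1 / t) ^ j * (t - 1) * (k : ℝ)⁻¹ * (k - j + (1 - α)) *
        (if (Sum.inr (Sum.inr (Sum.inl (i, y))) : MegastarV k ℓ m) ∈ S then (1:ℝ) else 0) -
      gth β γ i x S * (1 / t) ^ j * (t - 1) * (k : ℝ)⁻¹ * t * (j + α) *
        (if (Sum.inr (Sum.inr (Sum.inl (i, y))) : MegastarV k ℓ m) ∈ S then (0:ℝ) else 1) := by
    intro y
    unfold dterm
    by_cases h : (Sum.inr (Sum.inr (Sum.inl (i, y))) : MegastarV k ℓ m) ∈ S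
    · have hmem : y ∈ cliq i S := by simp [cliq, h]
      have hc : cliq i (S.erase (Sum.inr (Sum.inr (Sum.inl (i, y))))) = (cliq i S).erase y := by
        ext z; simp [cliq]
      have e : gB t β γ i x (S.erase (Sum.inr (Sum.inr (Sum.inl (i, y))))) =
          gth β γ i x S * ((1 / t) ^ j * t) := by
        unfold gB
        rw [gth_erase_of_ne _ _ _ _ _ _ (by simp) (by simp), hc, Finset.card_erase_of_mem hmem,
          ← hjdef]
        have hj1 : 1 ≤ j := Finset.card_pos.mpr ⟨y, hmem⟩
        obtain ⟨j', hj'⟩ : ∃ j', j = j' + 1 := ⟨j - 1, by omega⟩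
        rw [hj', pow_succ, Nat.add_sub_cancel]
        field_simp
      simp only [h, if_true]
      rw [col_ite_out, col_K, sum_ne, hjs', e, hα]
      unfold gB
      rw [← hjdef]
      simp only [h, if_true]
      split_ifs <;> ring
    · have hmem : y ∉ cliq i S := by simp [cliq, h]
      have hc : cliq i (insert (Sum.inr (Sum.inr (Sum.inl (i, y)))) S) = insert y (cliq i S) := by
        ext z; simp [cliq]
      have e : gB t β γ i x (insert (Sum.inr (Sum.inr (Sum.inl (i, y)))) S) =
          gth β γ i x S * ((1 / t) ^ j * (1 / t)) := by
        unfold gB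
        rw [gth_insert_of_ne _ _ _ _ _ _ (by simp) (by simp), hc, Finset.card_insert_of_notMem hmem,
          ← hjdef, pow_succ]
        ring
      simp only [h, if_false]
      rw [col_ite_in, col_K, sum_ne, hjs, e, hα]
      unfold gB
      rw [← hjdef]
      simp only [h, if_false]
      split_ifs <;> field_simp <;> ring
  simp_rw [hy]
  rw [Finset.sum_sub_distrib, ← Finset.mul_sum, ← Finset.mul_sum, hjs, hjs']
  ring

lemma eq_of_mid {a b : ℝ} (c : ℝ) (h : c = b) (h' : a ≤ c) : a ≤ b := h ▸ h'

lemma scalar_bound {k j : ℕ} {t β γ κ δ α p Y Z c : ℝ} {M : ℕ} (ht : 1 < t) (hk : 2 ≤ k)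
    (hκ : κ = (t - 1) ^ 2 / 16) (hβ0 : 0 < β) (hβ1 : β ≤ 1) (hγ0 : 0 < γ) (hγ2 : γ ≤ 1 / 2)
    (hδ2 : δ ≤ β * κ) (hδ3 : δ ≤ 1) (hM : 2 ≤ M * (t - 1))
    (hjk : j ≤ k) (hp : p = (1 / t) ^ j) (hα01 : α = 0 ∨ α = 1)
    (hZ : Z = j * (k - j + (1 - α)) - t * (k - j) * (j + α))
    (hc : c = (t - 1) * (k : ℝ)⁻¹ * Z)
    (hY : Y = c ∨ (α = 0 ∧ Y = β * c) ∨ (α = 1 ∧ Y = δ + β * κ + β * (1 - γ) * c)) :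
    p * Y ≤ if j = 0 then 0 else (t + κ) * ((1 / t) ^ k * t ^ M) := by
  have ht0 : 0 < t := by linarith
  have ht1 : 0 < t - 1 := by linarith
  have hκ0 : 0 < κ := by rw [hκ]; positivity
  have hk' : (2:ℝ) ≤ k := by exact_mod_cast hk
  have hk0 : (0:ℝ) < k := by linarith
  have hκt : κ ≤ t * (t - 1) / 4 := by rw [hκ]; nlinarith
  have hp0 : 0 < p := by rw [hp]; positivity
  have hjk' : (j:ℝ) ≤ k := by exact_mod_cast hjk
  have hj0 : (0:ℝ) ≤ j := by positivity
  have hZle : Z ≤ j * (1 - (t - 1) * (k - j)) := by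
    rw [hZ]
    rcases hα01 with h | h <;> rw [h]
    · apply le_of_eq; ring
    · nlinarith [mul_nonneg ht0.le (sub_nonneg.mpr hjk')]
  have hβκ : 0 < β * κ := by positivity
  have hβγ : 0 < β * (1 - γ) := mul_pos hβ0 (by linarith)
  by_cases hjz : j = 0
  · rw [if_pos hjz]
    apply mul_nonpos_of_nonneg_of_nonpos hp0.le
    have hc0 : α = 0 → c = 0 := by
      intro h; rw [hc, hZ, h, hjz]; simp
    have hc1 : α = 1 → c = - (t * (t - 1)) := by
      intro h
      rw [hc, hZ, h, hjz]; field_simp; simp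
    have htt : 0 < t * (t - 1) := by positivity
    rcases hY with h | ⟨h, h'⟩ | ⟨h, h'⟩
    · rcases hα01 with h2 | h2
      · rw [h, hc0 h2]
      · rw [h, hc1 h2]; linarith
    · rw [h', hc0 h]; simp
    · rw [h', hc1 h]
      have h1 : β * (t * (t - 1)) * (1 / 2) ≤ β * (t * (t - 1)) * (1 - γ) :=
        mul_le_mul_of_nonneg_left (by linarith) (by positivity)
      have h2 := mul_le_mul_of_nonneg_left hκt hβ0.le
      linarith
  · rw [if_neg hjz]
    have hj1 : (1:ℝ) ≤ j := by exact_mod_cast Nat.one_le_iff_ne_zero.mpr hjz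
    by_cases hMj : M + j ≤ k
    · have hMj' : (M:ℝ) + j ≤ k := by exact_mod_cast hMj
      have h2 : 2 ≤ (t - 1) * (k - j) := by
        have : (t - 1) * M ≤ (t - 1) * (k - j) :=
          mul_le_mul_of_nonneg_left (by linarith) ht1.le
        linarith
      have hMp : 0 < M := by
        rcases Nat.eq_zero_or_pos M with h | h
        · rw [h] at hM; norm_num at hM
        · exact h
      have hM1 : (1:ℝ) ≤ M := by exact_mod_cast hMp
      have hkj1 : (1:ℝ) ≤ k - j := by linarith
      have hZ2 : Z ≤ - ((t - 1) / 2 * (j * (k - j))) := by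
        have : (j:ℝ) * (1 - (t - 1) * (k - j)) ≤ j * (- ((t - 1) * (k - j) / 2)) :=
          mul_le_mul_of_nonneg_left (by linarith) hj0
        linarith
      have hjj : (k:ℝ) / 2 ≤ j * (k - j) := by nlinarith
      have hc2 : c ≤ - (4 * κ) := by
        have hZ3 : Z ≤ - ((t - 1) / 4 * k) := by
          have : (t - 1) / 2 * ((k:ℝ) / 2) ≤ (t - 1) / 2 * (j * (k - j)) :=
            mul_le_mul_of_nonneg_left hjj (by linarith)
          linarith
        have : c ≤ (t - 1) * (k : ℝ)⁻¹ * (- ((t - 1) / 4 * k)) := by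
          rw [hc]
          exact mul_le_mul_of_nonneg_left hZ3 (by positivity)
        refine this.trans (le_of_eq ?_)
        rw [hκ]; field_simp; norm_num
      refine le_trans ?_ (show (0:ℝ) ≤ _ by positivity)
      apply mul_nonpos_of_nonneg_of_nonpos hp0.le
      have hcneg : c ≤ 0 := by linarith
      have hb : β * κ + β * κ + β * (1 - γ) * c ≤ 0 := by
        have h5 : β * (1 - γ) * c ≤ β * (1 - γ) * (- (4 * κ)) :=
          mul_le_mul_of_nonneg_left hc2 hβγ.le
        have h6 : 0 ≤ β * κ * (1 / 2 - γ) := mul_nonneg hβκ.le (by linarith)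
        linarith
      rcases hY with h | ⟨h, h'⟩ | ⟨h, h'⟩
      · rw [h]; exact hcneg
      · rw [h']; exact mul_nonpos_of_nonneg_of_nonpos hβ0.le hcneg
      · rw [h']; linarith
    · have hc3 : c ≤ t - 1 := by
        have hZ3 : Z ≤ k := by
          have := mul_nonneg hj0 (mul_nonneg ht1.le (sub_nonneg.mpr hjk'))
          linarith
        have : c ≤ (t - 1) * (k : ℝ)⁻¹ * k := by
          rw [hc]
          exact mul_le_mul_of_nonneg_left hZ3 (by positivity)
        refine this.trans (le_of_eq ?_)
        field_simp
      have hpk : p ≤ (1 / t) ^ k * t ^ M := by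
        have h7 : (1 / t) ^ (j + M) ≤ (1 / t) ^ k :=
          pow_le_pow_of_le_one (by positivity) (by rw [div_le_one ht0]; linarith) (by omega)
        have h8 : p = (1 / t) ^ (j + M) * t ^ M := by
          rw [hp, pow_add, mul_assoc, ← mul_pow, one_div_mul_cancel ht0.ne', one_pow, mul_one]
        rw [h8]
        exact mul_le_mul_of_nonneg_right h7 (by positivity)
      have hYt : Y ≤ t + κ := by
        rcases hY with h | ⟨h, h'⟩ | ⟨h, h'⟩
        · rw [h]; linarith
        · rw [h']
          have h9 := mul_le_mul_of_nonneg_left hc3 hβ0.le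
          have h10 := mul_le_of_le_one_left ht1.le hβ1
          linarith
        · rw [h']
          have h9 := mul_le_mul_of_nonneg_left hc3 hβγ.le
          have h10 : β * (1 - γ) ≤ 1 := mul_le_one₀ hβ1 (by linarith) (by linarith)
          have h11 := mul_le_of_le_one_left ht1.le h10
          have h12 := mul_le_of_le_one_left hκ0.le hβ1
          linarith
      calc p * Y ≤ p * (t + κ) := mul_le_mul_of_nonneg_left hYt hp0.le
        _ ≤ ((1 / t) ^ k * t ^ M) * (t + κ) := mul_le_mul_of_nonneg_right hpk (by linarith)
        _ = _ := by ring

lemma gB_drift_le {k ℓ m : ℕ} {t β γ κ : ℝ} {M : ℕ} (ht : 1 < t) (hk : 2 ≤ k) (hl : 0 < ℓ)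
    (hm : 0 < m) (hκ : κ = (t - 1) ^ 2 / 16) (hγ : γ = κ / m) (hβ : β = 1 / (κ * t ^ 2 * ℓ))
    (hβ1 : β ≤ 1) (hm1 : 2 * κ ≤ m) (hm2 : t ^ 2 ≤ m) (hM : 2 ≤ M * (t - 1))
    (i : Fin ℓ) (x : Fin m) (S : Finset (MegastarV k ℓ m)) :
    drift (t ^ 2) (mw k ℓ m) (gB t β γ i x) S ≤
      if (cliq i S).card = 0 then 0 else (t + κ) * ((1 / t) ^ k * t ^ M) := by
  have ht0 : 0 < t := by linarith
  have ht1 : 0 < t - 1 := by linarith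
  have hκ0 : 0 < κ := by rw [hκ]; positivity
  have hl' : (1:ℝ) ≤ ℓ := by exact_mod_cast hl
  have hm' : (1:ℝ) ≤ m := by exact_mod_cast hm
  have hβ0 : 0 < β := by rw [hβ]; positivity
  have hγ0 : 0 < γ := by rw [hγ]; positivity
  have hγ2 : γ ≤ 1 / 2 := by
    rw [hγ, div_le_iff₀ (by positivity)]; linarith
  have hγm : γ * m = κ := by rw [hγ]; field_simp
  have hδ1 : β * γ * t ^ 2 = ((ℓ : ℝ) * m)⁻¹ := by
    rw [hβ, hγ]; field_simp
  have hδ2 : ((ℓ : ℝ) * m)⁻¹ ≤ β * κ := by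
    rw [← hδ1, ← hγm]
    have : β * γ * t ^ 2 ≤ β * γ * m := by gcongr
    linarith
  have hδ3 : ((ℓ : ℝ) * m)⁻¹ ≤ 1 := inv_le_one_of_one_le₀ (by nlinarith)
  have hx := gB_dterm_x (k := k) (r := t ^ 2) (by positivity) ht0 hβ0.le hβ1 hγ0.le
    (by linarith) i x S
  have ha := gB_dterm_a (k := k) (r := t ^ 2) (by positivity) ht0 hβ0.le hγ0.le i x S
  have hK := gB_dterm_K (k := k) (β := β) (γ := γ) ht0 i x S _ rfl
  have hjk : (cliq i S).card ≤ k := by simpa using (cliq i S).card_le_univ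
  rw [gB_drift_split, hK]
  clear hK
  generalize dterm (t ^ 2) (mw k ℓ m) (gB t β γ i x) S (Sum.inl (i, x)) = d1 at hx ⊢
  generalize dterm (t ^ 2) (mw k ℓ m) (gB t β γ i x) S (Sum.inr (Sum.inl i)) = d2 at ha ⊢
  unfold gth
  generalize (cliq i S).card = j at hx ha hjk ⊢
  have key := fun α Y c h1 h2 h3 => scalar_bound (α := α) (Y := Y) (c := c)
    ht hk hκ hβ0 hβ1 hγ0 hγ2 hδ2 hδ3 hM hjk rfl h1 rfl h2 h3
  by_cases h1 : (Sum.inl (i, x) : MegastarV k ℓ m) ∈ S <;>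
    by_cases h2 : (Sum.inr (Sum.inl i) : MegastarV k ℓ m) ∈ S <;>
    simp only [h1, h2, if_true, if_false] at hx ha ⊢
  · refine le_trans (eq_of_mid ?_ ?_ ?_) (key 1 _ _ (Or.inr rfl) rfl (Or.inr (Or.inr ⟨rfl, rfl⟩)))
    · exact (1 / t) ^ j * ((ℓ : ℝ) * m)⁻¹ + (1 / t) ^ j * (β * γ) * m +
        β * (1 - γ) * (1 / t) ^ j * (t - 1) * (k : ℝ)⁻¹ *
          (j * (k - j + (1 - 1)) - t * (k - j) * (j + 1))
    · rw [← hγm]; ring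
    · linarith
  · refine le_trans (eq_of_mid ?_ ?_ ?_) (key 0 _ _ (Or.inl rfl) rfl (Or.inr (Or.inl ⟨rfl, rfl⟩)))
    · exact (1 / t) ^ j * ((ℓ : ℝ) * m)⁻¹ - (1 / t) ^ j * (β * γ) * t ^ 2 +
        β * (1 / t) ^ j * (t - 1) * (k : ℝ)⁻¹ *
          (j * (k - j + (1 - 0)) - t * (k - j) * (j + 0))
    · rw [← hδ1]; ring
    · linarith
  · refine le_trans (eq_of_mid ?_ ?_ ?_) (key 1 _ _ (Or.inr rfl) rfl (Or.inl rfl))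
    · exact 1 * (1 / t) ^ j * (t - 1) * (k : ℝ)⁻¹ *
          (j * (k - j + (1 - 1)) - t * (k - j) * (j + 1))
    · ring
    · linarith
  · refine le_trans (eq_of_mid ?_ ?_ ?_) (key 0 _ _ (Or.inl rfl) rfl (Or.inl rfl))
    · exact 1 * (1 / t) ^ j * (t - 1) * (k : ℝ)⁻¹ *
          (j * (k - j + (1 - 0)) - t * (k - j) * (j + 0))
    · ring
    · linarith

lemma drift_lin {V : Type*} [Fintype V] [DecidableEq V]
    (r : ℝ) (w : V → V → ℝ) (f g : Finset V → ℝ) (Q c : ℝ) (S : Finset V) :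
    drift r w (fun S => f S + Q * g S + c) S = drift r w f S + Q * drift r w g S := by
  unfold drift
  rw [Finset.mul_sum, ← Finset.sum_add_distrib]
  refine Finset.sum_congr rfl fun v _ => ?_
  split_ifs <;> ring

lemma extq_le_epot {k ℓ m : ℕ} {t : ℝ} (ht : 1 < t) (hk : 0 < k) (hl : 0 < ℓ) (hm : 0 < m)
    (n : ℕ) (S : Finset (MegastarV k ℓ m)) :
    extq (t ^ 2) (mw k ℓ m) n S ≤ epot t (mlam k ℓ m) S := by
  have ht0 : 0 < t := by linarith
  have : Nonempty (MegastarV k ℓ m) := ⟨Sum.inr (Sum.inr (Sum.inr ()))⟩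
  refine extq_le (by nlinarith) (mw_nonneg k ℓ m) (mw_row k ℓ m hk hl hm) _
    (fun S => by unfold epot; positivity) (by simp [epot]) (fun _ => True)
    (fun S _ h => absurd trivial h) (fun S _ => ?_) n S
  refine (epot_drift ht (mw_nonneg k ℓ m) (mlam_nonneg k ℓ m) (mlam_le k ℓ m hl hm)
    (mlam_bal k ℓ m hk hl hm) S).trans ?_
  have h1 : 0 ≤ epot t (mlam k ℓ m) S := by unfold epot; positivity
  have h2 : 0 ≤ flux (mw k ℓ m) (mlam k ℓ m) S := by
    unfold flux
    refine Finset.sum_nonneg fun v _ => ?_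
    split_ifs
    · exact le_rfl
    · exact mul_nonneg (mlam_nonneg _ _ _ v) (Finset.sum_nonneg fun u _ => by
        split_ifs; exacts [mw_nonneg _ _ _ u v, le_rfl])
  have : 0 ≤ (t - 1) ^ 2 * epot t (mlam k ℓ m) S * flux (mw k ℓ m) (mlam k ℓ m) S := by positivity
  linarith

lemma extq_le_one {k ℓ m : ℕ} {t : ℝ} (ht : 1 < t) (hk : 0 < k) (hl : 0 < ℓ) (hm : 0 < m)
    (n : ℕ) (S : Finset (MegastarV k ℓ m)) :
    extq (t ^ 2) (mw k ℓ m) n S ≤ 1 := by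
  refine (extq_le_epot ht hk hl hm n S).trans ?_
  unfold epot
  exact Real.rpow_le_one (by positivity) (by rw [div_le_one (by linarith)]; linarith)
    (Finset.sum_nonneg fun v _ => mlam_nonneg _ _ _ v)

lemma extq_reservoir {k ℓ m : ℕ} {t β γ κ E Q : ℝ} {M N : ℕ} (ht : 1 < t) (hk : 2 ≤ k)
    (hl : 0 < ℓ)
    (hm : 0 < m) (hκ : κ = (t - 1) ^ 2 / 16) (hγ : γ = κ / m) (hβ : β = 1 / (κ * t ^ 2 * ℓ))
    (hβ1 : β ≤ 1) (hm1 : 2 * κ ≤ m) (hm2 : t ^ 2 ≤ m) (hM : 2 ≤ M * (t - 1))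
    (hN : 2 * (N : ℝ) ≤ (ℓ : ℝ) * m) (hE : E = (t + κ) * ((1 / t) ^ k * t ^ M))
    (hQ : Q = E * (2 * ℓ) * t ^ N / (t - 1) ^ 2)
    (i : Fin ℓ) (x : Fin m) (n : ℕ) :
    extq (t ^ 2) (mw k ℓ m) n {Sum.inl (i, x)} ≤ β + Q + (1 / t) ^ N := by
  have ht0 : 0 < t := by linarith
  have ht1 : 0 < t - 1 := by linarith
  have hκ0 : 0 < κ := by rw [hκ]; positivity
  have hl' : (0:ℝ) < ℓ := by positivity
  have hm' : (0:ℝ) < m := by positivity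
  have hE0 : 0 < E := by rw [hE]; positivity
  have hQ0 : 0 < Q := by rw [hQ]; positivity
  have hβ0 : 0 < β := by rw [hβ]; positivity
  have hγ0 : 0 < γ := by rw [hγ]; positivity
  have hγ1 : γ ≤ 1 := by rw [hγ, div_le_iff₀ hm']; linarith
  have : Nonempty (MegastarV k ℓ m) := ⟨Sum.inr (Sum.inr (Sum.inr ()))⟩
  have he0 : ∀ S, 0 < epot t (mlam k ℓ m) S := fun S => by unfold epot; positivity
  have hB0 : ∀ S : Finset (MegastarV k ℓ m), 0 ≤ gB t β γ i x S := fun S =>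
    mul_nonneg (by positivity) (gth_bounds hβ0.le hβ1 hγ0.le hγ1 i x S).1
  have hN0 : 0 < (1 / t) ^ N := by positivity
  have main := extq_le (r := t ^ 2) (by nlinarith) (mw_nonneg k ℓ m)
    (mw_row k ℓ m (by omega) hl hm)
    (fun S => gB t β γ i x S + Q * epot t (mlam k ℓ m) S + (1 / t) ^ N)
    (fun S => by have := hB0 S; have := he0 S; positivity)
    (by
      have : gB t β γ i x (∅ : Finset (MegastarV k ℓ m)) = 1 := by simp [gB, gth, cliq]
      simp only [this]
      have := mul_pos hQ0 (he0 ∅)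
      linarith)
    (fun S => ∑ v ∈ S, mlam k ℓ m v ≤ N)
    (fun S n hS => by
      refine (extq_le_epot ht (by omega) hl hm n S).trans ?_
      have h1 : epot t (mlam k ℓ m) S ≤ (1 / t) ^ N := by
        unfold epot
        rw [← Real.rpow_natCast]
        exact Real.rpow_le_rpow_of_exponent_ge (by positivity)
          (by rw [div_le_one ht0]; linarith) (not_le.mp hS).le
      have := hB0 S
      have := mul_pos hQ0 (he0 S)
      linarith)
    (fun S hS => by
      rw [drift_lin]
      have h1 := gB_drift_le ht hk hl hm hκ hγ hβ hβ1 hm1 hm2 hM i x S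
      have h2 := epot_drift ht (mw_nonneg k ℓ m) (mlam_nonneg k ℓ m) (mlam_le k ℓ m hl hm)
        (mlam_bal k ℓ m (by omega) hl hm) S
      have hf0 : 0 ≤ flux (mw k ℓ m) (mlam k ℓ m) S := by
        unfold flux
        refine Finset.sum_nonneg fun v _ => ?_
        split_ifs
        · exact le_rfl
        · exact mul_nonneg (mlam_nonneg _ _ _ v) (Finset.sum_nonneg fun u _ => by
            split_ifs; exacts [mw_nonneg _ _ _ u v, le_rfl])
      have h3 := mul_le_mul_of_nonneg_left h2 hQ0.le
      have hq : 0 ≤ Q * ((t - 1) ^ 2 * epot t (mlam k ℓ m) S * flux (mw k ℓ m) (mlam k ℓ m) S) := by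
        have := (he0 S).le
        positivity
      by_cases hj : (cliq i S).card = 0
      · rw [if_pos hj] at h1
        linarith
      · rw [if_neg hj, ← hE] at h1
        have h4 := flux_lower (by omega) hl hm i S N hN hS (Nat.pos_of_ne_zero hj)
        have h5 : (1 / t) ^ N ≤ epot t (mlam k ℓ m) S := by
          unfold epot
          rw [← Real.rpow_natCast]
          exact Real.rpow_le_rpow_of_exponent_ge (by positivity)
            (by rw [div_le_one ht0]; linarith) hS
        have h6 : E = Q * ((t - 1) ^ 2 * (1 / t) ^ N * (2 * (ℓ:ℝ))⁻¹) := by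
          rw [hQ, one_div, inv_pow]; field_simp
        have h7 : E ≤ Q * ((t - 1) ^ 2 * epot t (mlam k ℓ m) S *
            flux (mw k ℓ m) (mlam k ℓ m) S) := by
          have h8 := (he0 S).le
          rw [h6]; gcongr
        linarith)
    n {Sum.inl (i, x)}
  refine main.trans ?_
  have h1 : gB t β γ i x ({Sum.inl (i, x)} : Finset (MegastarV k ℓ m)) = β := by
    simp [gB, gth, cliq]
  have h2 : epot t (mlam k ℓ m) {Sum.inl (i, x)} ≤ 1 := by
    unfold epot
    exact Real.rpow_le_one (by positivity) (by rw [div_le_one (by linarith)]; linarith)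
      (Finset.sum_nonneg fun v _ => mlam_nonneg _ _ _ v)
  simp only [h1]
  have := mul_le_of_le_one_right hQ0.le h2
  linarith

lemma dist_le {k ℓ m : ℕ} {t X : ℝ} (ht : 1 < t) (hk : 0 < k) (hl : 0 < ℓ) (hm : 0 < m)
    (n : ℕ) (hX0 : 0 ≤ X)
    (hX : ∀ i x, extq (t ^ 2) (mw k ℓ m) n {Sum.inl (i, x)} ≤ X) :
    moranDist (t ^ 2) (mw k ℓ m) (uniformSingleton (MegastarV k ℓ m)) n ∅ ≤
      X + (ℓ + ℓ * k + 1) / ((ℓ:ℝ) * m) := by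
  rw [dist_empty]
  have hl' : (0:ℝ) < ℓ := by positivity
  have hm' : (0:ℝ) < m := by positivity
  set C : ℝ := (Fintype.card (MegastarV k ℓ m) : ℝ) with hC
  have hCval : C = (ℓ:ℝ) * m + (ℓ + (ℓ * k + 1)) := by
    rw [hC]; simp
  have h1 : ∑ S, uniformSingleton (MegastarV k ℓ m) S * extq (t ^ 2) (mw k ℓ m) n S =
      C⁻¹ * ∑ v, extq (t ^ 2) (mw k ℓ m) n {v} := by
    unfold uniformSingleton
    simp only [ite_mul, zero_mul]
    rw [← Finset.sum_filter, ← Finset.mul_sum]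
    congr 1
    have : (Finset.univ.filter fun S : Finset (MegastarV k ℓ m) => S.card = 1) =
        Finset.univ.map ⟨_, Finset.singleton_injective⟩ := by
      ext S
      simp [Finset.card_eq_one, eq_comm]
    rw [this, Finset.sum_map]
    rfl
  rw [h1, Fintype.sum_sum_type, inv_mul_eq_div]
  have h2 : ∑ p, extq (t ^ 2) (mw k ℓ m) n {Sum.inl p} ≤ (ℓ:ℝ) * m * X := by
    refine (Finset.sum_le_sum fun p _ => hX p.1 p.2).trans (le_of_eq ?_)
    simp
  have h3 : ∑ p, extq (t ^ 2) (mw k ℓ m) n {Sum.inr p} ≤ (ℓ:ℝ) + (ℓ * k + 1) := by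
    refine (Finset.sum_le_sum fun p _ => extq_le_one ht hk hl hm n _).trans (le_of_eq ?_)
    simp
  have hC0 : 0 < C := by rw [hCval]; positivity
  have hD0 : (0:ℝ) ≤ ℓ + ℓ * k + 1 := by positivity
  rw [div_le_iff₀ hC0]
  have h4 : (ℓ:ℝ) + ℓ * k + 1 ≤ (ℓ + ℓ * k + 1) / ((ℓ:ℝ) * m) * C := by
    rw [div_mul_eq_mul_div, le_div_iff₀ (by positivity)]
    apply mul_le_mul_of_nonneg_left _ hD0
    rw [hCval]
    have : (0:ℝ) ≤ (ℓ + (ℓ * k + 1)) := by positivity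
    linarith
  have h5 : (ℓ:ℝ) * m * X ≤ X * C := by
    rw [mul_comm]
    apply mul_le_mul_of_nonneg_left _ hX0
    rw [hCval]
    have : (0:ℝ) ≤ (ℓ + (ℓ * k + 1)) := by positivity
    linarith
  rw [add_mul]
  linarith

/-- **Megastars are strongly amplifying** (Theorem 1.4 / Corollary 1.8).  For every
`r > 1` and every `ε > 0` there is an integer `ℓ₀ ≥ 2` such that for every integer
`ℓ ≥ ℓ₀`, with `k = ⌈(log ℓ)^23⌉`, the discrete-time Moran process with fitness `r` on
the `(k,ℓ,ℓ)`-megastar, started from a single initial mutant at a uniformly random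
vertex, has extinction probability at most `ε`. -/
theorem megastar_strongly_amplifying (r : ℝ) (hr : 1 < r) (ε : ℝ) (hε : 0 < ε) :
    ∃ ℓ₀ : ℕ, 2 ≤ ℓ₀ ∧ ∀ ℓ : ℕ, ℓ₀ ≤ ℓ →
      ∀ k : ℕ, k = ⌈Real.log (ℓ : ℝ) ^ 23⌉₊ →
        extinctionProb r (outWeights (megastarOut k ℓ ℓ))
          (uniformSingleton (MegastarV k ℓ ℓ)) ≤ ε := by
  obtain ⟨t, ht, rfl⟩ : ∃ t : ℝ, 1 < t ∧ r = t ^ 2 :=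
    ⟨Real.sqrt r, by rw [Real.lt_sqrt (by norm_num)]; simpa using hr,
      (Real.sq_sqrt (by linarith)).symm⟩
  have ht0 : 0 < t := by linarith
  have ht1 : 0 < t - 1 := by linarith
  obtain ⟨κ, hκ⟩ : ∃ κ : ℝ, κ = (t - 1) ^ 2 / 16 := ⟨_, rfl⟩
  have hκ0 : 0 < κ := by rw [hκ]; positivity
  obtain ⟨M, hM⟩ : ∃ M : ℕ, 2 ≤ M * (t - 1) := by
    obtain ⟨M, hM⟩ := exists_nat_ge (2 / (t - 1))
    exact ⟨M, by rwa [div_le_iff₀ ht1] at hM⟩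
  obtain ⟨N, hN⟩ : ∃ N : ℕ, (1 / t) ^ N < ε / 4 :=
    exists_pow_lt_of_lt_one (by positivity) (by rw [div_lt_one ht0]; exact ht)
  obtain ⟨C, hC⟩ : ∃ C : ℝ, C = (t + κ) * t ^ M * 2 * t ^ N / (t - 1) ^ 2 := ⟨_, rfl⟩
  have hC0 : 0 < C := by rw [hC]; positivity
  have hlogt : 0 < Real.log t := Real.log_pos ht
  have hlog : Filter.Tendsto (fun ℓ : ℕ => Real.log (ℓ:ℝ)) Filter.atTop Filter.atTop :=
    Real.tendsto_log_atTop.comp tendsto_natCast_atTop_atTop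
  have hcast := tendsto_natCast_atTop_atTop (R := ℝ)
  have ev1 := hlog.eventually_ge_atTop (max 2 (2 / Real.log t))
  have ev2 : ∀ᶠ ℓ : ℕ in Filter.atTop, Real.log (ℓ:ℝ) ^ 23 ≤ ε / 8 * ℓ := by
    have h := (Real.isLittleO_pow_log_id_atTop (n := 23)).comp_tendsto hcast
    have h' := h.def (show 0 < ε / 8 by positivity)
    filter_upwards [h'] with ℓ hℓ
    simp only [Function.comp_apply, id, Real.norm_eq_abs] at hℓ
    refine (le_abs_self _).trans (hℓ.trans ?_)
    rw [abs_of_nonneg (by positivity)]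
  have ev3 := hcast.eventually_ge_atTop (24 / ε)
  have ev4 := hcast.eventually_ge_atTop (1 / (κ * t ^ 2 * min 1 (ε / 4)))
  have ev5 := hcast.eventually_ge_atTop (C / (ε / 4))
  have ev6 := hcast.eventually_ge_atTop (max (2 * κ) (max (t ^ 2) (2 * (N:ℝ))))
  have ev7 := Filter.eventually_ge_atTop (α := ℕ) 2
  obtain ⟨ℓ₀, h₀⟩ := Filter.eventually_atTop.mp
    (ev1.and (ev2.and (ev3.and (ev4.and (ev5.and (ev6.and ev7))))))
  refine ⟨max ℓ₀ 2, le_max_right _ _, fun ℓ hℓ k hk => ?_⟩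
  obtain ⟨h1, h2, h3, h4, h5, h6, h7⟩ := h₀ ℓ (le_trans (le_max_left _ _) hℓ)
  have hl : 0 < ℓ := by omega
  have hl1 : (1:ℝ) ≤ ℓ := by exact_mod_cast hl
  have hl0 : (0:ℝ) < ℓ := by linarith
  have hy2 : 2 ≤ Real.log (ℓ:ℝ) := (le_max_left _ _).trans h1
  have hyt : 2 / Real.log t ≤ Real.log (ℓ:ℝ) := (le_max_right _ _).trans h1
  obtain ⟨y, hy⟩ : ∃ y, y = Real.log (ℓ:ℝ) := ⟨_, rfl⟩
  rw [← hy] at hy2 hyt h2 hk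
  have hkge : y ^ 23 ≤ k := by rw [hk]; exact Nat.le_ceil _
  have hkle : (k:ℝ) ≤ y ^ 23 + 1 := by
    rw [hk]; exact (Nat.ceil_lt_add_one (by positivity)).le
  have hysq : y ^ 2 ≤ y ^ 23 := pow_le_pow_right₀ (by linarith) (by norm_num)
  have hk2 : 2 ≤ k := by
    have : (2:ℝ) ≤ k := by nlinarith
    exact_mod_cast this
  have hpow : (ℓ:ℝ) * (1 / t) ^ k ≤ 1 / ℓ := by
    have e1 : (1 / t) ^ k = Real.exp (- (k * Real.log t)) := by
      rw [one_div, inv_pow, Real.exp_neg, Real.exp_nat_mul, Real.exp_log ht0]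
    have e2 : (ℓ:ℝ) = Real.exp y := by rw [hy, Real.exp_log hl0]
    rw [e1, e2, ← Real.exp_add, one_div, ← Real.exp_neg]
    apply Real.exp_le_exp.mpr
    have e3 : 2 ≤ y * Real.log t := by rwa [div_le_iff₀ hlogt] at hyt
    have e4 : y ^ 2 * Real.log t ≤ k * Real.log t :=
      mul_le_mul_of_nonneg_right (hysq.trans hkge) hlogt.le
    have e5 : y * 2 ≤ y * (y * Real.log t) := mul_le_mul_of_nonneg_left e3 (by linarith)
    linarith
  obtain ⟨β, hβ⟩ : ∃ β : ℝ, β = 1 / (κ * t ^ 2 * ℓ) := ⟨_, rfl⟩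
  obtain ⟨E, hE⟩ : ∃ E : ℝ, E = (t + κ) * ((1 / t) ^ k * t ^ M) := ⟨_, rfl⟩
  obtain ⟨Q, hQ⟩ : ∃ Q : ℝ, Q = E * (2 * ℓ) * t ^ N / (t - 1) ^ 2 := ⟨_, rfl⟩
  have hβmin : β ≤ min 1 (ε / 4) := by
    have hmin : 0 < min 1 (ε / 4) := lt_min one_pos (by positivity)
    rw [hβ, div_le_iff₀ (by positivity)]
    rw [div_le_iff₀ (by positivity)] at h4
    linarith
  have hβ1 : β ≤ 1 := hβmin.trans (min_le_left _ _)
  have hβ2 : β ≤ ε / 4 := hβmin.trans (min_le_right _ _)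
  have hβ0 : 0 < β := by rw [hβ]; positivity
  have hQ0 : 0 < Q := by rw [hQ, hE]; positivity
  have hQle : Q ≤ ε / 4 := by
    have e1 : Q = C * (ℓ * (1 / t) ^ k) := by rw [hQ, hE, hC]; ring
    have e2 : C * (ℓ * (1 / t) ^ k) ≤ C * (1 / ℓ) := mul_le_mul_of_nonneg_left hpow hC0.le
    have e3 : C * (1 / ℓ) ≤ ε / 4 := by
      rw [mul_one_div, div_le_iff₀ hl0]
      rw [div_le_iff₀ (by positivity)] at h5
      linarith
    linarith
  have hm1 : 2 * κ ≤ (ℓ:ℝ) := (le_max_left _ _).trans h6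
  have hm2 : t ^ 2 ≤ (ℓ:ℝ) := ((le_max_left _ _).trans (le_max_right _ _)).trans h6
  have hN2 : 2 * (N:ℝ) ≤ (ℓ:ℝ) * ℓ := by
    have : 2 * (N:ℝ) ≤ (ℓ:ℝ) := ((le_max_right _ _).trans (le_max_right _ _)).trans h6
    nlinarith
  unfold extinctionProb
  refine ciSup_le fun n => ?_
  rw [outWeights_eq]
  refine (dist_le (X := β + Q + (1 / t) ^ N) ht (by omega) hl hl n (by positivity)
    (fun i x => extq_reservoir ht hk2 hl hl hκ rfl hβ hβ1 hm1 hm2 hM hN2 hE hQ i x n)).trans ?_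
  have hlast : ((ℓ:ℝ) + ℓ * k + 1) / ((ℓ:ℝ) * ℓ) ≤ ε / 4 := by
    rw [div_le_iff₀ (by positivity)]
    have e3 : 3 ≤ ε / 8 * ℓ := by
      rw [div_le_iff₀ hε] at h3
      linarith
    have e4 : (ℓ:ℝ) + ℓ * k + 1 ≤ ℓ * (y ^ 23 + 3) := by
      have := mul_le_mul_of_nonneg_left hkle hl0.le
      linarith
    have e5 : (ℓ:ℝ) * (y ^ 23 + 3) ≤ ℓ * (ε / 8 * ℓ + ε / 8 * ℓ) :=
      mul_le_mul_of_nonneg_left (by linarith) hl0.le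
    linarith
  linarith
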